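/- Let k ≥ 1 and let l, l' be integers coprime to k such that either l' ≡ l (mod k) or l·l' ≡ 1 (mod k). Then there exists a 2×2 integer matrix M with det M = 1 or det M = −1 whose associated linear map of ℝ² maps the cone C((1,0), (l,k)) = {a·(1,0) + b·(l,k) : a, b ≥ 0} bijectively onto the cone C((1,0), (l',k)) = {a·(1,0) + b·(l',k) : a, b ≥ 0}. -/

import Mathlib

open Matrix

/-- The cone spanned by two vectors `u, v ∈ ℝ²`:
`C(u, v) = {a·u + b·v : a, b ≥ 0}`. -/
def cone (u v : ℝ × ℝ) : Set (ℝ × ℝ) :=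
  {w | ∃ a b : ℝ, 0 ≤ a ∧ 0 ≤ b ∧ w = a • u + b • v}

theorem cone_comm (u v : ℝ × ℝ) : cone u v = cone v u := by
  ext w
  constructor <;> rintro ⟨a, b, ha, hb, rfl⟩ <;> exact ⟨b, a, hb, ha, add_comm _ _⟩

theorem LinearMap.image_cone (f : ℝ × ℝ →ₗ[ℝ] ℝ × ℝ) (u v : ℝ × ℝ) :
    f '' cone u v = cone (f u) (f v) := by
  ext w
  constructor
  · rintro ⟨_, ⟨a, b, ha, hb, rfl⟩, rfl⟩
    exact ⟨a, b, ha, hb, by simp only [map_add, map_smul]⟩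
  · rintro ⟨a, b, ha, hb, rfl⟩
    exact ⟨a • u + b • v, ⟨a, b, ha, hb, rfl⟩, by simp only [map_add, map_smul]⟩

/-- The linear endomorphism of `ℝ × ℝ` associated with a `2 × 2` integer matrix. -/
def Matrix.toLinProd (M : Matrix (Fin 2) (Fin 2) ℤ) : ℝ × ℝ →ₗ[ℝ] ℝ × ℝ where
  toFun w := ((M 0 0 : ℝ) * w.1 + (M 0 1 : ℝ) * w.2, (M 1 0 : ℝ) * w.1 + (M 1 1 : ℝ) * w.2)
  map_add' x y := by ext <;> simp <;> ring
  map_smul' c x := by ext <;> simp <;> ring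

theorem Matrix.toLinProd_apply (M : Matrix (Fin 2) (Fin 2) ℤ) (w : ℝ × ℝ) :
    M.toLinProd w =
      ((M 0 0 : ℝ) * w.1 + (M 0 1 : ℝ) * w.2, (M 1 0 : ℝ) * w.1 + (M 1 1 : ℝ) * w.2) :=
  rfl

theorem Matrix.toLinProd_injective {M : Matrix (Fin 2) (Fin 2) ℤ} (hM : M.det ≠ 0) :
    Function.Injective M.toLinProd := by
  have hdet : (M 0 0 : ℝ) * M 1 1 - M 0 1 * M 1 0 ≠ 0 := by
    rw [Matrix.det_fin_two] at hM
    exact_mod_cast hM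
  rw [← LinearMap.ker_eq_bot, LinearMap.ker_eq_bot']
  rintro ⟨x, y⟩ h
  simp only [Matrix.toLinProd_apply, Prod.mk_eq_zero] at h ⊢
  obtain ⟨h₀, h₁⟩ := h
  constructor <;> apply (mul_eq_zero.mp _).resolve_left hdet
  · linear_combination (M 1 1 : ℝ) * h₀ - (M 0 1 : ℝ) * h₁
  · linear_combination (M 0 0 : ℝ) * h₁ - (M 1 0 : ℝ) * h₀

theorem Matrix.bijOn_toLinProd_cone {M : Matrix (Fin 2) (Fin 2) ℤ} (hM : M.det ≠ 0)
    (u v : ℝ × ℝ) :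
    Set.BijOn M.toLinProd (cone u v) (cone (M.toLinProd u) (M.toLinProd v)) := by
  rw [← LinearMap.image_cone]
  exact (Matrix.toLinProd_injective hM).injOn.bijOn_image

/-- Let `k ≥ 1` and let `l, l'` be integers coprime to `k` with `l' ≡ l (mod k)`
or `l·l' ≡ 1 (mod k)`. Then some integer matrix of determinant `±1` maps the cone
spanned by `(1,0)`, `(l,k)` bijectively onto the cone spanned by `(1,0)`, `(l',k)`. -/
theorem exists_det_pm_one_matrix_maps_cone (k l l' : ℤ) (hk : 1 ≤ k)
    (hl : IsCoprime l k) (hl' : IsCoprime l' k)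
    (hcong : l' ≡ l [ZMOD k] ∨ l * l' ≡ 1 [ZMOD k]) :
    ∃ M : Matrix (Fin 2) (Fin 2) ℤ, (M.det = 1 ∨ M.det = -1) ∧
      Set.BijOn
        (fun w : ℝ × ℝ =>
          ((M 0 0 : ℝ) * w.1 + (M 0 1 : ℝ) * w.2,
           (M 1 0 : ℝ) * w.1 + (M 1 1 : ℝ) * w.2))
        (cone ((1 : ℝ), (0 : ℝ)) ((l : ℝ), (k : ℝ)))
        (cone ((1 : ℝ), (0 : ℝ)) ((l' : ℝ), (k : ℝ))) := by
  rcases hcong with h | h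
  · obtain ⟨m, hm⟩ := h.symm.dvd
    have hm' : (l' : ℝ) - l = k * m := by exact_mod_cast hm
    have hdet : (!![1, m; 0, 1] : Matrix (Fin 2) (Fin 2) ℤ).det = 1 := by
      simp [Matrix.det_fin_two]
    refine ⟨!![1, m; 0, 1], Or.inl hdet, ?_⟩
    convert Matrix.bijOn_toLinProd_cone (hdet.trans_ne one_ne_zero) (1, 0) ((l : ℝ), (k : ℝ))
      using 2
    · rfl
    · simp [Matrix.toLinProd_apply]
    · simp only [Matrix.toLinProd_apply]
      ext <;> simp
      linear_combination hm'
  · obtain ⟨b, hb⟩ := h.dvd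
    have hb' : (1 : ℝ) - l * l' = k * b := by exact_mod_cast hb
    have hdet : (!![l', b; k, -l] : Matrix (Fin 2) (Fin 2) ℤ).det = -1 := by
      simp only [Matrix.det_fin_two_of]
      linear_combination hb
    refine ⟨!![l', b; k, -l], Or.inr hdet, ?_⟩
    rw [cone_comm (1, 0) ((l' : ℝ), (k : ℝ))]
    convert Matrix.bijOn_toLinProd_cone (hdet.trans_ne (by decide)) (1, 0) ((l : ℝ), (k : ℝ))
      using 2
    · rfl
    · simp [Matrix.toLinProd_apply]
    · simp only [Matrix.toLinProd_apply]
      ext <;> simp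
      · linear_combination hb'
      · ring
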